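/- Local avalanches are anticorrelated: in the stationary process of the DSS, for every site x ∈ {1,…,L}, every t ≥ 1 and every τ ≥ 1: if 1 ≤ τ ≤ x then Cov(s(x,t), s(x,t+τ)) < 0, and if τ ≥ x+1 then Cov(s(x,t), s(x,t+τ)) = 0. -/

import Mathlib

namespace DSS

/-- A state of the DSS on `L` sites: a stable field `z : Fin L → Bool` together with a
finite multiset `w` of waiting particles (particles past site `L` have left the system). -/
structure State (L : ℕ) where
  z : Fin L → Bool
  w : Multiset (Fin L)

variable {L : ℕ}

/-- The multiset holding the right neighbour of `x`; empty if the particle leaves the system. -/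
def succSite (L : ℕ) (x : Fin L) : Multiset (Fin L) :=
  if h : x.val + 1 < L then {(⟨x.val + 1, h⟩ : Fin L)} else 0

/-- Evolution of a waiting particle at `x` when `z x = 1`: the waiting particle moves to
`x+1` and the stable particle at `x` becomes a waiting particle at `x`. -/
def topple (s : State L) (x : Fin L) : State L :=
  ⟨Function.update s.z x false, s.w + succSite L x⟩

/-- Evolution of a waiting particle at `x` when `z x = 0`, settling branch (probability p). -/
def settle (s : State L) (x : Fin L) : State L :=
  ⟨Function.update s.z x true, s.w.erase x⟩

/-- Evolution of a waiting particle at `x` when `z x = 0`, jumping branch (probability q). -/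
def jump (s : State L) (x : Fin L) : State L :=
  ⟨s.z, s.w.erase x + succSite L x⟩

/-- `stabilizeAux p q R n s c` is the probability that, evolving one waiting particle at a
time (the particle being selected by the rule `R`), the process started from `s` reaches
within `n` elementary steps a stable state whose stable field is `c`. -/
noncomputable def stabilizeAux (p q : ℝ) (R : State L → Option (Fin L)) :
    ℕ → State L → (Fin L → Bool) → ℝ
  | 0, s, c => if s.w = 0 ∧ s.z = c then 1 else 0
  | n + 1, s, c =>
    match R s with
    | none => if s.z = c then 1 else 0
    | some x =>
      if s.z x then stabilizeAux p q R n (topple s x) c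
      else p * stabilizeAux p q R n (settle s x) c
        + q * stabilizeAux p q R n (jump s x) c

/-- The canonical evolution rule: evolve the leftmost waiting particle. -/
def minRule (s : State L) : Option (Fin L) :=
  if h : s.w = 0 then none
  else some (s.w.toFinset.min'
    (Finset.nonempty_iff_ne_empty.mpr (by simpa [Multiset.toFinset_eq_empty] using h)))

/-- A termination measure: the stabilization process started from `s` ends after at most
`fuel s` elementary steps, whatever the rule and the randomness. -/
def potential (s : State L) : ℕ :=
  (s.w.map fun x => L + 1 - x.val).sum + ∑ x : Fin L, (if s.z x then L + 1 - x.val else 0)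

def fuel (s : State L) : ℕ := 2 * potential s + Multiset.card s.w

/-- Add one waiting particle at site `1` (index `0`). -/
def addGrain (r : Fin L → Bool) : State L :=
  ⟨r, if h : 0 < L then {(⟨0, h⟩ : Fin L)} else 0⟩

/-- The driven-dissipative transition kernel `W` of the DSS: add a particle at site 1 and
stabilize. -/
noncomputable def Wker (p q : ℝ) (r r' : Fin L → Bool) : ℝ :=
  stabilizeAux p q minRule (fuel (addGrain r)) (addGrain r) r'

/-- `W` as a matrix on stable configurations. -/
noncomputable def Wmat (p q : ℝ) (L : ℕ) :
    Matrix (Fin L → Bool) (Fin L → Bool) ℝ :=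
  Matrix.of fun r r' => Wker p q r r'

/-- The product Bernoulli(p) measure `ψ(r) = p^(Σ r) q^(L - Σ r)`. -/
noncomputable def psi (p q : ℝ) {L : ℕ} (r : Fin L → Bool) : ℝ :=
  p ^ (Finset.univ.filter fun x => r x = true).card *
    q ^ (L - (Finset.univ.filter fun x => r x = true).card)



/-- Same as `stabilizeAux`, additionally recording the number of topplings performed at each
site: `stabilizeSAux p q R n s c k` is the probability that the process started from `s`
terminates within `n` steps on the stable field `c` having performed exactly `k x`
topplings (transfers of a waiting particle from `x` to `x+1`) at each site `x`. -/
noncomputable def stabilizeSAux (p q : ℝ) (R : State L → Option (Fin L)) :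
    ℕ → State L → (Fin L → Bool) → (Fin L → ℕ) → ℝ
  | 0, s, c, k => if s.w = 0 ∧ s.z = c ∧ k = 0 then 1 else 0
  | n + 1, s, c, k =>
    match R s with
    | none => if s.z = c ∧ k = 0 then 1 else 0
    | some x =>
      if s.z x then
        (if k x = 0 then 0
          else stabilizeSAux p q R n (topple s x) c (Function.update k x (k x - 1)))
      else
        p * stabilizeSAux p q R n (settle s x) c k
          + q * (if k x = 0 then 0
              else stabilizeSAux p q R n (jump s x) c (Function.update k x (k x - 1)))

/-- Joint avalanche kernel: `Kker p q r r' k` is the probability that, adding one particle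
at site 1 to the stable configuration `r`, the resulting avalanche leads to the stable
configuration `r'` with exactly `k x` topplings at each site `x`. -/
noncomputable def Kker (p q : ℝ) (r r' : Fin L → Bool) (k : Fin L → ℕ) : ℝ :=
  stabilizeSAux p q minRule (fuel (addGrain r)) (addGrain r) r' k

/-- `E[s(x,t)]`: expectation of the number of topplings at site `x` in the `t`-th avalanche
(`t ≥ 1`), for the stationary process started from `ψ`. -/
noncomputable def meanS (p q : ℝ) (L : ℕ) (t : ℕ) (x : Fin L) : ℝ :=
  ∑ r0 : Fin L → Bool, ∑ r1 : Fin L → Bool, ∑ r2 : Fin L → Bool,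
    ∑' k : Fin L → ℕ,
      psi p q r0 * ((Wmat p q L) ^ (t - 1)) r0 r1 * Kker p q r1 r2 k * (k x : ℝ)

/-- `E[s(x,t) s(x',t+τ)]` (`t, τ ≥ 1`) for the stationary process started from `ψ`. -/
noncomputable def corrS (p q : ℝ) (L : ℕ) (t τ : ℕ) (x x' : Fin L) : ℝ :=
  ∑ r0 : Fin L → Bool, ∑ r1 : Fin L → Bool, ∑ r2 : Fin L → Bool,
    ∑ r3 : Fin L → Bool, ∑ r4 : Fin L → Bool,
      ∑' k1 : Fin L → ℕ, ∑' k2 : Fin L → ℕ,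
        psi p q r0 * ((Wmat p q L) ^ (t - 1)) r0 r1 *
          Kker p q r1 r2 k1 * (k1 x : ℝ) *
          ((Wmat p q L) ^ (τ - 1)) r2 r3 *
          Kker p q r3 r4 k2 * (k2 x' : ℝ)


/-- `Cov(s(x,t), s(x,t+τ))` in the stationary process. -/
noncomputable def covS (p q : ℝ) (L : ℕ) (t τ : ℕ) (x : Fin L) : ℝ :=
  corrS p q L t τ x x - meanS p q L t x * meanS p q L (t + τ) x

/-! ### The closed form of the stabilization kernel -/

section ClosedForm

/-- Occupation number of a site. -/
def occ (b : Bool) : ℤ := if b then 1 else 0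

/-- Bernoulli weight of a site. -/
def bern (p q : ℝ) (b : Bool) : ℝ := if b then p else q

/-- Law of the final value `c` of a site with initial value `z` that receives `n` particles. -/
def site (p q : ℝ) (n : ℤ) (z c : Bool) : ℝ :=
  if 1 ≤ n then bern p q c else if z = c then 1 else 0

/-- Number of topplings at `y` when `s` stabilizes to `c`, by conservation of particles. -/
def outflow (s : State L) (c : Fin L → Bool) (y : Fin L) : ℤ :=
  ∑ u ∈ Finset.Iic y, ((s.w.count u : ℤ) + occ (s.z u) - occ (c u))

/-- Number of waiting particles ever present at `y` when `s` stabilizes to `c`, where the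
particle made waiting by a toppling replaces the one that left. -/
def inflow (s : State L) (c : Fin L → Bool) (y : Fin L) : ℤ :=
  outflow s c y - occ (s.z y) + occ (c y)

/-- Closed form of the probability that `s` stabilizes to `c`. -/
def stabWeight (p q : ℝ) (s : State L) (c : Fin L → Bool) : ℝ :=
  ∏ y, site p q (inflow s c y) (s.z y) (c y)

variable {p q : ℝ}

lemma count_succSite (x y : Fin L) :
    (succSite L x).count y = if (y : ℕ) = x + 1 then 1 else 0 := by
  unfold succSite
  split_ifs with h1 h2 h2
  · rw [Multiset.count_singleton, if_pos (Fin.ext h2)]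
  · rw [Multiset.count_singleton, if_neg (fun h => h2 (by simp [h]))]
  · omega
  · simp

lemma sum_Iic_count_succSite (x y : Fin L) :
    ∑ u ∈ Finset.Iic y, ((succSite L x).count u : ℤ) = if x < y then 1 else 0 := by
  simp only [count_succSite]
  push_cast
  split_ifs with h
  · have h' : (x : ℕ) + 1 < L := by have := y.isLt; have : (x : ℕ) < y := h; omega
    rw [Finset.sum_eq_single (⟨x + 1, h'⟩ : Fin L)]
    · simp
    · intro b _ hb
      rw [if_neg fun h => hb (Fin.ext h)]
    · intro hb
      exact absurd (Finset.mem_Iic.2 (Fin.le_def.2 (Nat.succ_le_of_lt h))) hb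
  · refine Finset.sum_eq_zero fun u hu => if_neg fun hu' => h ?_
    have := Fin.le_def.1 (Finset.mem_Iic.1 hu)
    exact show (x : ℕ) < y by omega

lemma sum_Iic_single (x y : Fin L) (a : ℤ) :
    ∑ u ∈ Finset.Iic y, (if u = x then a else 0) = if x ≤ y then a else 0 := by
  simp [Finset.sum_ite_eq']

lemma outflow_topple (s : State L) (c : Fin L → Bool) (x y : Fin L) (hz : s.z x = true) :
    outflow (topple s x) c y = outflow s c y - if y = x then 1 else 0 := by
  have h : outflow (topple s x) c y = outflow s c y
      + ∑ u ∈ Finset.Iic y, ((succSite L x).count u : ℤ)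
      - ∑ u ∈ Finset.Iic y, (if u = x then (1 : ℤ) else 0) := by
    unfold outflow
    rw [← Finset.sum_add_distrib, ← Finset.sum_sub_distrib]
    refine Finset.sum_congr rfl fun u _ => ?_
    by_cases hu : u = x
    · subst hu; simp [topple, hz, occ]; ring
    · simp [topple, hu]; ring
  rw [h, sum_Iic_count_succSite, sum_Iic_single]
  rcases lt_trichotomy x y with h | h | h
  · simp [h, h.le, h.ne']
  · simp [h]
  · simp [h.le.not_gt, h.not_ge, h.ne]

lemma outflow_settle (s : State L) (c : Fin L → Bool) (x y : Fin L) (hz : s.z x = false)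
    (hx : x ∈ s.w) : outflow (settle s x) c y = outflow s c y := by
  refine Finset.sum_congr rfl fun u _ => ?_
  by_cases hu : u = x
  · subst hu
    have := Multiset.one_le_count_iff_mem.2 hx
    simp [settle, hz, occ, Multiset.count_erase_self]
    omega
  · simp [settle, hu, Multiset.count_erase_of_ne hu]

lemma outflow_jump (s : State L) (c : Fin L → Bool) (x y : Fin L) (hx : x ∈ s.w) :
    outflow (jump s x) c y = outflow s c y - if y = x then 1 else 0 := by
  have h : outflow (jump s x) c y = outflow s c y
      + ∑ u ∈ Finset.Iic y, ((succSite L x).count u : ℤ)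
      - ∑ u ∈ Finset.Iic y, (if u = x then (1 : ℤ) else 0) := by
    unfold outflow
    rw [← Finset.sum_add_distrib, ← Finset.sum_sub_distrib]
    refine Finset.sum_congr rfl fun u _ => ?_
    by_cases hu : u = x
    · subst hu
      have := Multiset.one_le_count_iff_mem.2 hx
      simp [jump, Multiset.count_erase_self]
      omega
    · simp [jump, hu, Multiset.count_erase_of_ne hu]; ring
  rw [h, sum_Iic_count_succSite, sum_Iic_single]
  rcases lt_trichotomy x y with h | h | h
  · simp [h, h.le, h.ne']
  · simp [h]
  · simp [h.le.not_gt, h.not_ge, h.ne]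

lemma inflow_eq (s : State L) (c : Fin L → Bool) (y : Fin L) :
    inflow s c y = s.w.count y
      + ∑ u ∈ Finset.Iio y, ((s.w.count u : ℤ) + occ (s.z u) - occ (c u)) := by
  unfold inflow outflow
  rw [← Finset.Iio_insert, Finset.sum_insert (by simp)]
  ring

lemma outflow_nonneg_of_site_ne_zero {s : State L} {c : Fin L → Bool} {y : Fin L}
    (hn : 0 ≤ inflow s c y) (h : site p q (inflow s c y) (s.z y) (c y) ≠ 0) :
    0 ≤ outflow s c y := by
  have h2 : outflow s c y = inflow s c y + occ (s.z y) - occ (c y) := by unfold inflow; ring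
  unfold site at h
  rw [h2]
  split_ifs at h with h3 h4
  · have : 0 ≤ occ (s.z y) := by unfold occ; split_ifs <;> simp
    have : occ (c y) ≤ 1 := by unfold occ; split_ifs <;> simp
    omega
  · rw [h4]; omega
  · exact absurd rfl h

lemma count_le_inflow {s : State L} {c : Fin L → Bool} (x : Fin L)
    (h : ∀ y < x, site p q (inflow s c y) (s.z y) (c y) ≠ 0) :
    (s.w.count x : ℤ) ≤ inflow s c x := by
  induction x using WellFoundedLT.induction with
  | ind x ih =>
    rw [inflow_eq]
    suffices 0 ≤ ∑ u ∈ Finset.Iio x, ((s.w.count u : ℤ) + occ (s.z u) - occ (c u)) by linarith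
    by_cases hx : (x : ℕ) = 0
    · rw [Finset.sum_eq_zero]
      intro u hu
      have := Fin.lt_def.1 (Finset.mem_Iio.1 hu)
      omega
    · have hx' : (x : ℕ) - 1 < L := by have := x.isLt; omega
      let y : Fin L := ⟨x - 1, hx'⟩
      have hyx : y < x := show (x : ℕ) - 1 < x by omega
      have hI : Finset.Iio x = Finset.Iic y := by
        ext u
        rw [Finset.mem_Iio, Finset.mem_Iic, Fin.lt_def, Fin.le_def]
        change _ ↔ (u : ℕ) ≤ x - 1
        omega
      rw [hI]
      refine outflow_nonneg_of_site_ne_zero (p := p) (q := q) ?_ (h y hyx)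
      exact le_trans (by positivity) (ih y hyx fun u hu => h u (hu.trans hyx))

lemma outflow_nonneg {s : State L} {c : Fin L → Bool} (h : stabWeight p q s c ≠ 0)
    (y : Fin L) : 0 ≤ outflow s c y := by
  have h' : ∀ y, site p q (inflow s c y) (s.z y) (c y) ≠ 0 := fun y =>
    Finset.prod_ne_zero_iff.1 h y (Finset.mem_univ y)
  exact outflow_nonneg_of_site_ne_zero
    (le_trans (by positivity) (count_le_inflow y fun u _ => h' u)) (h' y)

lemma one_le_inflow {s : State L} {c : Fin L → Bool} {x : Fin L} (hx : x ∈ s.w)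
    (h : ∏ y ∈ Finset.univ.erase x, site p q (inflow s c y) (s.z y) (c y) ≠ 0) :
    1 ≤ inflow s c x := by
  have h1 := count_le_inflow (p := p) (q := q) (s := s) (c := c) x fun y hy =>
    Finset.prod_ne_zero_iff.1 h y (Finset.mem_erase.2 ⟨hy.ne, Finset.mem_univ y⟩)
  have := Multiset.one_le_count_iff_mem.2 hx
  omega

lemma stabWeight_topple {s : State L} {x : Fin L} (c : Fin L → Bool) (hx : x ∈ s.w)
    (hz : s.z x = true) : stabWeight p q (topple s x) c = stabWeight p q s c := by
  have hin : ∀ y, inflow (topple s x) c y = inflow s c y := by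
    intro y
    unfold inflow
    rw [outflow_topple s c x y hz]
    by_cases hy : y = x
    · subst hy; simp [topple, hz, occ]
    · simp [topple, hy]
  unfold stabWeight
  rw [← Finset.mul_prod_erase _ _ (Finset.mem_univ x),
    ← Finset.mul_prod_erase Finset.univ (fun y => site p q (inflow s c y) (s.z y) (c y))
      (Finset.mem_univ x)]
  have hR : ∏ y ∈ Finset.univ.erase x, site p q (inflow (topple s x) c y)
      ((topple s x).z y) (c y)
      = ∏ y ∈ Finset.univ.erase x, site p q (inflow s c y) (s.z y) (c y) := by
    refine Finset.prod_congr rfl fun y hy => ?_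
    rw [hin]
    simp only [topple, Function.update_of_ne (Finset.ne_of_mem_erase hy)]
  rw [hR, hin]
  by_cases h : ∏ y ∈ Finset.univ.erase x, site p q (inflow s c y) (s.z y) (c y) = 0
  · rw [h, mul_zero, mul_zero]
  · have := one_le_inflow hx h
    simp [site, this]

lemma site_step (hpq : p + q = 1) {n : ℤ} (hn : 1 ≤ n) (c : Bool) :
    p * site p q (n - 1) true c + q * site p q (n - 1) false c = site p q n false c := by
  unfold site
  rw [if_pos hn]
  by_cases h : 1 ≤ n - 1
  · rw [if_pos h, if_pos h, ← add_mul, hpq, one_mul]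
  · rw [if_neg h, if_neg h]
    cases c <;> simp [bern]

lemma stabWeight_settle_add_jump (hpq : p + q = 1) {s : State L} {x : Fin L}
    (c : Fin L → Bool) (hx : x ∈ s.w) (hz : s.z x = false) :
    p * stabWeight p q (settle s x) c + q * stabWeight p q (jump s x) c
      = stabWeight p q s c := by
  have hs : ∀ y, inflow (settle s x) c y = inflow s c y - if y = x then 1 else 0 := by
    intro y
    unfold inflow
    rw [outflow_settle s c x y hz hx]
    by_cases hy : y = x
    · subst hy; simp [settle, hz, occ]; ring
    · simp [settle, hy]
  have hj : ∀ y, inflow (jump s x) c y = inflow s c y - if y = x then 1 else 0 := by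
    intro y
    unfold inflow
    rw [outflow_jump s c x y hx]
    simp [jump]; ring
  unfold stabWeight
  rw [← Finset.mul_prod_erase _ _ (Finset.mem_univ x),
    ← Finset.mul_prod_erase Finset.univ
      (fun y => site p q (inflow (jump s x) c y) ((jump s x).z y) (c y)) (Finset.mem_univ x),
    ← Finset.mul_prod_erase Finset.univ (fun y => site p q (inflow s c y) (s.z y) (c y))
      (Finset.mem_univ x)]
  have hRs : ∏ y ∈ Finset.univ.erase x, site p q (inflow (settle s x) c y)
      ((settle s x).z y) (c y)
      = ∏ y ∈ Finset.univ.erase x, site p q (inflow s c y) (s.z y) (c y) := by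
    refine Finset.prod_congr rfl fun y hy => ?_
    have hy := Finset.ne_of_mem_erase hy
    rw [hs, if_neg hy, sub_zero]
    simp only [settle, Function.update_of_ne hy]
  have hRj : ∏ y ∈ Finset.univ.erase x, site p q (inflow (jump s x) c y)
      ((jump s x).z y) (c y)
      = ∏ y ∈ Finset.univ.erase x, site p q (inflow s c y) (s.z y) (c y) := by
    refine Finset.prod_congr rfl fun y hy => ?_
    rw [hj, jump, if_neg (Finset.ne_of_mem_erase hy), sub_zero]
  rw [hRs, hRj, hs, hj]
  by_cases h : ∏ y ∈ Finset.univ.erase x, site p q (inflow s c y) (s.z y) (c y) = 0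
  · rw [h]; ring
  · have h1 : (settle s x).z x = true := by simp [settle]
    have h2 : (jump s x).z x = false := hz
    rw [h1, h2, hz, if_pos rfl, ← mul_assoc, ← mul_assoc, ← add_mul,
      site_step hpq (one_le_inflow hx h)]

lemma outflow_of_w_eq_zero {s : State L} (hw : s.w = 0) (y : Fin L) :
    outflow s s.z y = 0 :=
  Finset.sum_eq_zero fun u _ => by simp [hw]

lemma stabWeight_of_w_eq_zero {s : State L} (hw : s.w = 0) (c : Fin L → Bool) :
    stabWeight p q s c = if s.z = c then 1 else 0 := by
  split_ifs with h
  · subst h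
    refine Finset.prod_eq_one fun y _ => ?_
    simp [site, inflow, outflow_of_w_eq_zero hw]
  · by_contra h0
    have h' : ∀ y, site p q (inflow s c y) (s.z y) (c y) ≠ 0 := fun y =>
      Finset.prod_ne_zero_iff.1 h0 y (Finset.mem_univ y)
    refine h (funext fun y => ?_)
    induction y using WellFoundedLT.induction with
    | ind y ih =>
      have hn : inflow s c y = 0 := by
        rw [inflow_eq, Finset.sum_eq_zero]
        · simp [hw]
        · intro u hu
          rw [ih u (Finset.mem_Iio.1 hu)]
          simp [hw]
      have := h' y
      rw [hn] at this
      by_contra hc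
      simp [site, hc] at this

end ClosedForm

section Fuel

lemma minRule_eq_none {s : State L} (h : minRule s = none) : s.w = 0 := by
  unfold minRule at h
  split_ifs at h with h'
  exact h'

lemma mem_of_minRule_eq_some {s : State L} {x : Fin L} (h : minRule s = some x) :
    x ∈ s.w := by
  unfold minRule at h
  split_ifs at h with h'
  rw [← Option.some.inj h]
  exact Multiset.mem_toFinset.1 (Finset.min'_mem _ _)

lemma w_eq_zero_of_fuel {s : State L} (h : fuel s ≤ 0) : s.w = 0 := by
  unfold fuel at h
  exact Multiset.card_eq_zero.1 (by omega)

lemma sum_map_succSite_le (x : Fin L) :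
    ((succSite L x).map fun y : Fin L => L + 1 - y.val).sum ≤ L - x := by
  unfold succSite
  split_ifs <;> simp

lemma card_succSite_le (x : Fin L) : Multiset.card (succSite L x) ≤ 1 := by
  unfold succSite
  split_ifs <;> simp

lemma sum_map_erase {s : State L} {x : Fin L} (hx : x ∈ s.w) :
    (L + 1 - x) + ((s.w.erase x).map fun y : Fin L => L + 1 - y.val).sum
      = (s.w.map fun y : Fin L => L + 1 - y.val).sum :=
  Multiset.sum_map_erase (f := fun y : Fin L => L + 1 - y.val) hx

/-- Contribution of the stable particles to the potential. -/
def stablePotential (z : Fin L → Bool) : ℕ :=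
  ∑ y : Fin L, if z y then L + 1 - y.val else 0

lemma potential_eq (s : State L) :
    potential s = (s.w.map fun y : Fin L => L + 1 - y.val).sum + stablePotential s.z := rfl

lemma stablePotential_update (z : Fin L → Bool) (x : Fin L) (b : Bool) :
    stablePotential (Function.update z x b) + (if z x then L + 1 - x.val else 0)
      = stablePotential z + if b then L + 1 - x.val else 0 := by
  unfold stablePotential
  rw [← Finset.add_sum_erase _ _ (Finset.mem_univ x),
    ← Finset.add_sum_erase Finset.univ (fun y : Fin L => if z y then L + 1 - y.val else 0)
      (Finset.mem_univ x)]
  have : ∑ y ∈ Finset.univ.erase x, (if Function.update z x b y then L + 1 - y.val else 0)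
      = ∑ y ∈ Finset.univ.erase x, (if z y then L + 1 - y.val else 0) :=
    Finset.sum_congr rfl fun y hy => by
      rw [Function.update_of_ne (Finset.ne_of_mem_erase hy)]
  rw [this, Function.update_self]
  ring

lemma fuel_topple_lt {s : State L} {x : Fin L} (hz : s.z x = true) :
    fuel (topple s x) < fuel s := by
  have h1 := sum_map_succSite_le x
  have h2 := card_succSite_le x
  have h3 := stablePotential_update s.z x false
  have := x.isLt
  simp only [hz, if_true, Bool.false_eq_true, if_false] at h3
  simp only [fuel, potential_eq, topple, Multiset.map_add, Multiset.sum_add, Multiset.card_add]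
  omega

lemma fuel_settle_lt {s : State L} {x : Fin L} (hx : x ∈ s.w) (hz : s.z x = false) :
    fuel (settle s x) < fuel s := by
  have h1 := sum_map_erase hx
  have h2 := Multiset.card_erase_add_one hx
  have h3 := stablePotential_update s.z x true
  simp only [hz, if_true, Bool.false_eq_true, if_false] at h3
  simp only [fuel, potential_eq, settle]
  omega

lemma fuel_jump_lt {s : State L} {x : Fin L} (hx : x ∈ s.w) :
    fuel (jump s x) < fuel s := by
  have h1 := sum_map_erase hx
  have h2 := Multiset.card_erase_add_one hx
  have h3 := sum_map_succSite_le x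
  have h4 := card_succSite_le x
  have := x.isLt
  simp only [fuel, potential_eq, jump, Multiset.map_add, Multiset.sum_add, Multiset.card_add]
  omega

end Fuel

section Kernels

variable {p q : ℝ}

lemma closedForm_of_w_eq_zero {s : State L} (hw : s.w = 0) (c : Fin L → Bool)
    (k : Fin L → ℕ) : (if s.z = c ∧ k = 0 then (1 : ℝ) else 0)
      = if ∀ y, (k y : ℤ) = outflow s c y then stabWeight p q s c else 0 := by
  rw [stabWeight_of_w_eq_zero hw]
  by_cases hz : s.z = c
  · subst hz
    have : k = 0 ↔ ∀ y, (k y : ℤ) = outflow s s.z y := by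
      simp [outflow_of_w_eq_zero hw, funext_iff]
    simp [this]
  · simp [hz]

lemma stabilizeAux_eq (hpq : p + q = 1) (n : ℕ) (s : State L) (c : Fin L → Bool)
    (hn : fuel s ≤ n) : stabilizeAux p q minRule n s c = stabWeight p q s c := by
  induction n generalizing s with
  | zero =>
    have hw := w_eq_zero_of_fuel hn
    simp [stabilizeAux, stabWeight_of_w_eq_zero hw, hw]
  | succ n ih =>
    rw [stabilizeAux]
    cases hR : minRule s with
    | none => exact (stabWeight_of_w_eq_zero (minRule_eq_none hR) c).symm
    | some x =>
      have hx := mem_of_minRule_eq_some hR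
      cases hz : s.z x with
      | true =>
        have := fuel_topple_lt hz
        simp only [hz, if_true]
        rw [ih _ (by omega), stabWeight_topple c hx hz]
      | false =>
        have := fuel_settle_lt hx hz
        have := fuel_jump_lt hx
        simp only [hz, Bool.false_eq_true, if_false]
        rw [ih _ (by omega), ih _ (by omega), stabWeight_settle_add_jump hpq c hx hz]

lemma update_pred_eq_iff {k : Fin L → ℕ} {x : Fin L} (hk : k x ≠ 0) (a : Fin L → ℤ) :
    (∀ y, ((Function.update k x (k x - 1) y : ℕ) : ℤ) = a y - if y = x then 1 else 0)
      ↔ ∀ y, (k y : ℤ) = a y := by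
  refine forall_congr' fun y => ?_
  by_cases hy : y = x
  · subst hy
    rw [Function.update_self, if_pos rfl]
    omega
  · rw [Function.update_of_ne hy, if_neg hy, sub_zero]

lemma stabilizeSAux_eq (hpq : p + q = 1) (n : ℕ) (s : State L) (c : Fin L → Bool)
    (k : Fin L → ℕ) (hn : fuel s ≤ n) :
    stabilizeSAux p q minRule n s c k
      = if ∀ y, (k y : ℤ) = outflow s c y then stabWeight p q s c else 0 := by
  induction n generalizing s k with
  | zero =>
    have hw := w_eq_zero_of_fuel hn
    rw [← closedForm_of_w_eq_zero hw, stabilizeSAux]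
    simp [hw]
  | succ n ih =>
    rw [stabilizeSAux]
    cases hR : minRule s with
    | none => exact closedForm_of_w_eq_zero (minRule_eq_none hR) c k
    | some x =>
      have hx := mem_of_minRule_eq_some hR
      cases hz : s.z x with
      | true =>
        have := fuel_topple_lt hz
        have hT := stabWeight_topple (p := p) (q := q) c hx hz
        simp only [hz, if_true]
        by_cases hk : k x = 0
        · rw [if_pos hk]
          split_ifs with hm
          · by_contra h0
            rw [← hT] at h0
            have h1 := outflow_nonneg (Ne.symm h0) x
            rw [outflow_topple s c x x hz, ← hm x, hk] at h1
            simp at h1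
          · rfl
        · rw [if_neg hk, ih _ _ (by omega), hT]
          simp only [outflow_topple s c x _ hz, update_pred_eq_iff hk]
      | false =>
        have := fuel_settle_lt hx hz
        have := fuel_jump_lt hx
        have hstep := stabWeight_settle_add_jump hpq c hx hz
        simp only [hz, Bool.false_eq_true, if_false]
        rw [ih _ _ (by omega)]
        simp only [outflow_settle s c x _ hz hx]
        by_cases hk : k x = 0
        · rw [if_pos hk, mul_zero, add_zero]
          split_ifs with hm
          · have h0 : stabWeight p q (jump s x) c = 0 := by
              by_contra h0
              have h1 := outflow_nonneg h0 x
              rw [outflow_jump s c x x hx, ← hm x, hk] at h1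
              simp at h1
            rw [← hstep, h0, mul_zero, add_zero]
          · rw [mul_zero]
        · rw [if_neg hk, ih _ _ (by omega)]
          simp only [outflow_jump s c x _ hx, update_pred_eq_iff hk]
          split_ifs
          · exact hstep
          · ring

end Kernels

/-! ### Adding several particles at once -/

section Grains

variable {p q : ℝ}

/-- Kernel of the stabilization of `T` waiting particles at the first site. -/
def grainKernel (p q : ℝ) (T : ℤ) (r r' : Fin L → Bool) : ℝ :=
  ∏ y, site p q (T + ∑ u ∈ Finset.Iio y, (occ (r u) - occ (r' u))) (r y) (r' y)

/-- Number of topplings at `x` when `T` particles added at the first site change `r`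
into `r'`. -/
def grainOut (T : ℤ) (r r' : Fin L → Bool) (x : Fin L) : ℤ :=
  T + ∑ u ∈ Finset.Iic x, (occ (r u) - occ (r' u))

lemma outflow_addGrain (r r' : Fin L → Bool) (x : Fin L) :
    outflow (addGrain r) r' x = grainOut 1 r r' x := by
  have hL : 0 < L := x.pos
  have h : ∑ u ∈ Finset.Iic x, (if u = ⟨0, hL⟩ then (1 : ℤ) else 0) = 1 := by
    rw [sum_Iic_single, if_pos (Fin.le_def.2 (Nat.zero_le _))]
  unfold outflow grainOut
  rw [← h, ← Finset.sum_add_distrib]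
  refine Finset.sum_congr rfl fun u _ => ?_
  simp [addGrain, hL, Multiset.count_singleton]
  ring

lemma stabWeight_addGrain (r r' : Fin L → Bool) :
    stabWeight p q (addGrain r) r' = grainKernel p q 1 r r' := by
  refine Finset.prod_congr rfl fun y _ => ?_
  have : inflow (addGrain r) r' y = 1 + ∑ u ∈ Finset.Iio y, (occ (r u) - occ (r' u)) := by
    unfold inflow
    rw [outflow_addGrain, grainOut, ← Finset.Iio_insert, Finset.sum_insert (by simp)]
    simp only [addGrain]
    ring
  rw [this]
  rfl

lemma Wker_eq (hpq : p + q = 1) (r r' : Fin L → Bool) :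
    Wker p q r r' = grainKernel p q 1 r r' := by
  rw [Wker, stabilizeAux_eq hpq _ _ _ le_rfl, stabWeight_addGrain]

lemma Kker_eq (hpq : p + q = 1) (r r' : Fin L → Bool) (k : Fin L → ℕ) :
    Kker p q r r' k
      = if ∀ y, (k y : ℤ) = grainOut 1 r r' y then grainKernel p q 1 r r' else 0 := by
  rw [Kker, stabilizeSAux_eq hpq _ _ _ _ le_rfl, stabWeight_addGrain]
  simp only [outflow_addGrain]

lemma tsum_Kker_mul (hpq : p + q = 1) (a : ℝ) (r r' : Fin L → Bool) (x : Fin L) :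
    ∑' k : Fin L → ℕ, a * Kker p q r r' k * (k x : ℝ)
      = a * Wker p q r r' * (grainOut 1 r r' x : ℝ) := by
  rw [Wker_eq hpq]
  by_cases h0 : grainKernel p q 1 r r' = 0
  · simp [Kker_eq hpq, h0]
  · have hnn : ∀ y, 0 ≤ grainOut 1 r r' y := fun y => by
      rw [← outflow_addGrain]
      exact outflow_nonneg (p := p) (q := q) (by rwa [stabWeight_addGrain]) y
    rw [tsum_eq_single fun y => (grainOut 1 r r' y).toNat]
    · rw [Kker_eq hpq, if_pos fun y => Int.toNat_of_nonneg (hnn y)]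
      congr 1
      exact_mod_cast Int.toNat_of_nonneg (hnn x)
    · intro k hk
      rw [Kker_eq hpq, if_neg, mul_zero, zero_mul]
      exact fun h => hk (funext fun y => by have := h y; omega)

lemma sum_Iio_succ {M : Type*} [AddCommMonoid M] (g : Fin (L + 1) → M) (y : Fin L) :
    ∑ u ∈ Finset.Iio y.succ, g u = g 0 + ∑ u ∈ Finset.Iio y, g u.succ := by
  have h1 : Finset.Iio y.succ = Finset.univ.filter (· < y.succ) := by ext; simp
  have h2 : Finset.Iio y = Finset.univ.filter (· < y) := by ext; simp
  rw [h1, h2, Finset.sum_filter, Finset.sum_filter, Fin.sum_univ_succ]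
  simp

lemma sum_Iic_succ {M : Type*} [AddCommMonoid M] (g : Fin (L + 1) → M) (y : Fin L) :
    ∑ u ∈ Finset.Iic y.succ, g u = g 0 + ∑ u ∈ Finset.Iic y, g u.succ := by
  have h1 : Finset.Iic y.succ = Finset.univ.filter (· ≤ y.succ) := by ext; simp
  have h2 : Finset.Iic y = Finset.univ.filter (· ≤ y) := by ext; simp
  rw [h1, h2, Finset.sum_filter, Finset.sum_filter, Fin.sum_univ_succ]
  simp

lemma sum_fin_succ_fun {M : Type*} [AddCommMonoid M] (g : (Fin (L + 1) → Bool) → M) :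
    ∑ r, g r = ∑ b, ∑ r : Fin L → Bool, g (Fin.cons b r) := by
  rw [← (Fin.consEquiv fun _ : Fin (L + 1) => Bool).sum_comp, Fintype.sum_prod_type]
  rfl

lemma grainKernel_cons (T : ℤ) (b b' : Bool) (r r' : Fin L → Bool) :
    grainKernel p q T (Fin.cons b r : Fin (L + 1) → Bool) (Fin.cons b' r')
      = site p q T b b' * grainKernel p q (T + occ b - occ b') r r' := by
  unfold grainKernel
  rw [Fin.prod_univ_succ]
  have h0 : Finset.Iio (0 : Fin (L + 1)) = ∅ := by ext; simp
  simp only [sum_Iio_succ, h0, Finset.sum_empty, add_zero, Fin.cons_zero, Fin.cons_succ]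
  congr 1
  refine Finset.prod_congr rfl fun y _ => ?_
  congr 1
  ring

lemma grainOut_cons_zero (T : ℤ) (b b' : Bool) (r r' : Fin L → Bool) :
    grainOut T (Fin.cons b r : Fin (L + 1) → Bool) (Fin.cons b' r') 0
      = T + occ b - occ b' := by
  have h0 : Finset.Iic (0 : Fin (L + 1)) = {0} := by ext; simp
  simp [grainOut, h0]
  ring

lemma grainOut_cons_succ (T : ℤ) (b b' : Bool) (r r' : Fin L → Bool) (y : Fin L) :
    grainOut T (Fin.cons b r : Fin (L + 1) → Bool) (Fin.cons b' r') y.succ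
      = grainOut (T + occ b - occ b') r r' y := by
  simp only [grainOut, sum_Iic_succ, Fin.cons_zero, Fin.cons_succ]
  ring

lemma psi_eq_prod (r : Fin L → Bool) : psi p q r = ∏ y, bern p q (r y) := by
  unfold psi bern
  rw [Finset.prod_ite, Finset.prod_const, Finset.prod_const]
  congr 2
  have := Finset.card_filter_add_card_filter_not (s := (Finset.univ : Finset (Fin L)))
    (fun x => r x = true)
  rw [Finset.card_univ, Fintype.card_fin] at this
  omega

lemma psi_cons (b : Bool) (r : Fin L → Bool) :
    psi p q (Fin.cons b r : Fin (L + 1) → Bool) = bern p q b * psi p q r := by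
  simp [psi_eq_prod, Fin.prod_univ_succ]

lemma sum_psi (hpq : p + q = 1) : ∑ r : Fin L → Bool, psi p q r = 1 := by
  induction L with
  | zero => simp [psi]
  | succ L ih =>
    simp only [sum_fin_succ_fun, psi_cons, ← Finset.mul_sum, ih]
    simpa [bern] using hpq

lemma sum_grainKernel (hpq : p + q = 1) (T : ℤ) (r : Fin L → Bool) :
    ∑ r', grainKernel p q T r r' = 1 := by
  induction L generalizing T with
  | zero => simp [grainKernel]
  | succ L ih =>
    rw [← Fin.cons_self_tail r]
    simp only [sum_fin_succ_fun, grainKernel_cons, ← Finset.mul_sum, ih]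
    by_cases h : 1 ≤ T
    · simpa [site, bern, h] using hpq
    · simp [site, h]

lemma sum_psi_mul_grainKernel (hpq : p + q = 1) (T : ℤ) (r' : Fin L → Bool) :
    ∑ r, psi p q r * grainKernel p q T r r' = psi p q r' := by
  induction L generalizing T with
  | zero => simp [grainKernel, psi]
  | succ L ih =>
    rw [← Fin.cons_self_tail r']
    simp only [sum_fin_succ_fun, grainKernel_cons, psi_cons]
    have h1 : ∀ b, ∑ r, bern p q b * psi p q r * (site p q T b (r' 0)
        * grainKernel p q (T + occ b - occ (r' 0)) r (Fin.tail r'))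
        = bern p q b * site p q T b (r' 0) * psi p q (Fin.tail r') := fun b => by
      simp only [mul_mul_mul_comm _ (psi p q _), ← Finset.mul_sum, ih]
    simp only [h1, ← Finset.sum_mul]
    congr 1
    by_cases h : 1 ≤ T
    · simp only [site, h, if_true, ← Finset.sum_mul]
      simp [bern, hpq]
    · simp [site, h]

lemma site_comp (hpq : p + q = 1) {m n : ℤ} (hm : 0 ≤ m) (hn : 0 ≤ n) (b c : Bool) :
    ∑ b', site p q m b b' * site p q n b' c = site p q (m + n) b c := by
  rcases hm.eq_or_lt with rfl | hm
  · simp [site]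
  rcases hn.eq_or_lt with rfl | hn
  · simp [site]
  · have h1 : 1 ≤ m := hm
    have h2 : 1 ≤ n := hn
    have h3 : 1 ≤ m + n := by omega
    simp only [site, h1, h2, h3, if_true, ← Finset.sum_mul]
    simp [bern, hpq]

lemma add_occ_sub_occ_nonneg {m : ℤ} (hm : 0 ≤ m) {b c : Bool} (h : site p q m b c ≠ 0) :
    0 ≤ m + occ b - occ c := by
  unfold site at h
  split_ifs at h with h3 h4
  · have : 0 ≤ occ b := by unfold occ; split_ifs <;> simp
    have : occ c ≤ 1 := by unfold occ; split_ifs <;> simp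
    omega
  · rw [h4]; omega
  · exact absurd rfl h

lemma grainKernel_comp (hpq : p + q = 1) {m n : ℤ} (hm : 0 ≤ m) (hn : 0 ≤ n)
    (r r'' : Fin L → Bool) :
    ∑ r', grainKernel p q m r r' * grainKernel p q n r' r''
      = grainKernel p q (m + n) r r'' := by
  induction L generalizing m n with
  | zero => simp [grainKernel]
  | succ L ih =>
    rw [← Fin.cons_self_tail r, ← Fin.cons_self_tail r'']
    simp only [sum_fin_succ_fun, grainKernel_cons, mul_mul_mul_comm, ← Finset.mul_sum]
    rw [← site_comp hpq hm hn, Finset.sum_mul]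
    refine Finset.sum_congr rfl fun b _ => ?_
    by_cases h1 : site p q m (r 0) b = 0
    · rw [h1]; ring
    by_cases h2 : site p q n b (r'' 0) = 0
    · rw [h2]; ring
    rw [ih (add_occ_sub_occ_nonneg hm h1) (add_occ_sub_occ_nonneg hn h2)]
    congr 2
    ring

lemma grainKernel_zero (r r' : Fin L → Bool) :
    grainKernel p q 0 r r' = if r = r' then 1 else 0 := by
  induction L with
  | zero => simp [grainKernel, Subsingleton.elim r r']
  | succ L ih =>
    rw [← Fin.cons_self_tail r, ← Fin.cons_self_tail r', grainKernel_cons]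
    simp only [Fin.cons_inj]
    by_cases h : r 0 = r' 0
    · simp [site, h, ih]
    · simp [site, h]

lemma Wmat_pow (hpq : p + q = 1) (n : ℕ) (r r' : Fin L → Bool) :
    (Wmat p q L ^ n) r r' = grainKernel p q n r r' := by
  induction n generalizing r' with
  | zero => simp [Matrix.one_apply, grainKernel_zero]
  | succ n ih =>
    rw [pow_succ, Matrix.mul_apply]
    have h1 : ∀ r'', Wmat p q L r'' r' = grainKernel p q 1 r'' r' := fun r'' =>
      Wker_eq hpq r'' r'
    simp only [ih, h1]
    rw [grainKernel_comp hpq (by positivity) (by norm_num)]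
    push_cast
    rfl

end Grains

/-! ### The lazy random walk absorbed at zero -/

section Walk

/-- Averaging over one step of the walk on `ℤ` that jumps by `±1` with probability `a` each
from the positive integers and is frozen elsewhere. -/
def walkStep (a : ℝ) : Module.End ℝ (ℤ → ℝ) where
  toFun f n := if 1 ≤ n then f n + a * (f (n + 1) - 2 * f n + f (n - 1)) else f n
  map_add' f g := by
    funext n
    by_cases h : 1 ≤ n
    · simp [h]; ring
    · simp [h]
  map_smul' c f := by
    funext n
    by_cases h : 1 ≤ n
    · simp [h]; ring
    · simp [h]

lemma walkStep_apply (a : ℝ) (f : ℤ → ℝ) (n : ℤ) :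
    walkStep a f n = if 1 ≤ n then f n + a * (f (n + 1) - 2 * f n + f (n - 1)) else f n := rfl

/-- Indicator of the absorbing half-line. -/
def absorbed (n : ℤ) : ℝ := if 1 ≤ n then 0 else 1

lemma walkStep_const (a c : ℝ) : walkStep a (fun _ => c) = fun _ => c := by
  funext n
  rw [walkStep_apply]
  split_ifs <;> ring

lemma walkStep_pow_const (a c : ℝ) (k : ℕ) : (walkStep a ^ k) (fun _ => c) = fun _ => c := by
  induction k with
  | zero => rfl
  | succ k ih => rw [pow_succ, Module.End.mul_apply, walkStep_const, ih]

lemma walkStep_sq (a : ℝ) :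
    walkStep a (fun n => (n : ℝ) ^ 2)
      = (fun n : ℤ => (n : ℝ) ^ 2) + (2 * a) • ((fun _ => 1) - absorbed) := by
  funext n
  rw [walkStep_apply]
  by_cases h : 1 ≤ n
  · simp [h, absorbed]; ring
  · simp [h, absorbed]

lemma walkStep_pow_sq_second_difference {a : ℝ} (ha : a ≠ 0) (k : ℕ) {n : ℤ} (hn : 1 ≤ n) :
    (walkStep a ^ k) (fun n => (n : ℝ) ^ 2) (n + 1)
      - 2 * (walkStep a ^ k) (fun n => (n : ℝ) ^ 2) n
      + (walkStep a ^ k) (fun n => (n : ℝ) ^ 2) (n - 1)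
      = 2 * (1 - (walkStep a ^ k) absorbed n) := by
  have h1 := congrFun (congrArg (walkStep a ^ k) (walkStep_sq a)) n
  rw [← Module.End.mul_apply, ← pow_succ, pow_succ', Module.End.mul_apply, walkStep_apply,
    if_pos hn, map_add, map_smul, map_sub, walkStep_pow_const] at h1
  simp only [Pi.add_apply, Pi.smul_apply, Pi.sub_apply, smul_eq_mul] at h1
  refine mul_left_cancel₀ ha ?_
  linarith

lemma walkStep_pow_absorbed_nonneg {a : ℝ} (ha : 0 ≤ a) (ha' : 2 * a ≤ 1) (k : ℕ) (n : ℤ) :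
    0 ≤ (walkStep a ^ k) absorbed n := by
  induction k generalizing n with
  | zero => simp only [pow_zero, Module.End.one_apply, absorbed]; split_ifs <;> simp
  | succ k ih =>
    rw [pow_succ', Module.End.mul_apply, walkStep_apply]
    split_ifs
    · have h1 := mul_nonneg ha (ih (n + 1))
      have h2 := mul_nonneg ha (ih (n - 1))
      have h3 := mul_nonneg (sub_nonneg.2 ha') (ih n)
      linarith
    · exact ih n

lemma walkStep_pow_absorbed_pos {a : ℝ} (ha : 0 < a) (ha' : 2 * a ≤ 1) (k : ℕ) {n : ℤ}
    (hn : n ≤ k) : 0 < (walkStep a ^ k) absorbed n := by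
  induction k generalizing n with
  | zero =>
    have : ¬ 1 ≤ n := by push_cast at hn; omega
    simp [absorbed, this]
  | succ k ih =>
    rw [pow_succ', Module.End.mul_apply, walkStep_apply]
    split_ifs
    · have h1 := mul_nonneg ha.le (walkStep_pow_absorbed_nonneg ha.le ha' k (n + 1))
      have h2 := mul_pos ha (ih (n := n - 1) (by push_cast at hn; omega))
      have h3 := mul_nonneg (sub_nonneg.2 ha') (walkStep_pow_absorbed_nonneg ha.le ha' k n)
      linarith
    · exact ih (by omega)

lemma walkStep_pow_absorbed_eq_zero (a : ℝ) (k : ℕ) {n : ℤ} (hn : k < n) :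
    (walkStep a ^ k) absorbed n = 0 := by
  induction k generalizing n with
  | zero =>
    have : 1 ≤ n := by push_cast at hn; omega
    simp [absorbed, this]
  | succ k ih =>
    push_cast at hn
    rw [pow_succ', Module.End.mul_apply, walkStep_apply, ih (by omega), ih (by omega),
      ih (by omega)]
    simp

variable {p q : ℝ}

lemma sum_bern_mul_site (hpq : p + q = 1) (T : ℤ) (h : ℤ → ℝ) :
    ∑ b, ∑ b', bern p q b * site p q T b b' * h (T + occ b - occ b')
      = walkStep (p * q) h T := by
  rw [walkStep_apply]
  by_cases hT : 1 ≤ T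
  · simp only [Fintype.sum_bool, bern, site, occ, hT, if_true, Bool.false_eq_true, if_false,
      add_sub_cancel_right, add_zero, sub_zero]
    obtain rfl : q = 1 - p := by linarith
    ring
  · simp only [Fintype.sum_bool, bern, site, occ, hT, if_true, if_false,
      add_sub_cancel_right, add_zero, sub_zero, Bool.true_eq_false, Bool.false_eq_true]
    obtain rfl : q = 1 - p := by linarith
    ring

/-- In the stationary state, the number of topplings at `x` caused by `T` particles is the
position of the absorbed walk started at `T` after as many steps as there are sites up to
`x`. -/
lemma sum_psi_mul_grainOut (hpq : p + q = 1) (f : ℤ → ℝ) (T : ℤ) (x : Fin L) :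
    ∑ r, ∑ r', psi p q r * grainKernel p q T r r' * f (grainOut T r r' x)
      = (walkStep (p * q) ^ ((x : ℕ) + 1)) f T := by
  induction L generalizing T with
  | zero => exact x.elim0
  | succ L ih =>
    have key : ∀ g : ℤ → Bool → Bool → (Fin L → Bool) → (Fin L → Bool) → ℝ,
        ∑ b, ∑ r : Fin L → Bool, ∑ b', ∑ r' : Fin L → Bool,
          bern p q b * psi p q r
            * (site p q T b b' * grainKernel p q (T + occ b - occ b') r r') * g T b b' r r'
        = ∑ b, ∑ b', bern p q b * site p q T b b' * ∑ r, ∑ r',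
          psi p q r * grainKernel p q (T + occ b - occ b') r r' * g T b b' r r' := by
      intro g
      refine Finset.sum_congr rfl fun b _ => ?_
      rw [Finset.sum_comm]
      refine Finset.sum_congr rfl fun b' _ => ?_
      simp only [Finset.mul_sum]
      refine Finset.sum_congr rfl fun r _ => Finset.sum_congr rfl fun r' _ => ?_
      ring
    simp only [sum_fin_succ_fun, psi_cons, grainKernel_cons]
    cases x using Fin.cases with
    | zero =>
      simp only [grainOut_cons_zero]
      rw [key fun T b b' _ _ => f (T + occ b - occ b')]
      simp only [← Finset.sum_mul, ← Finset.mul_sum, sum_grainKernel hpq, mul_one,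
        sum_psi hpq, one_mul]
      rw [sum_bern_mul_site hpq]
      simp
    | succ y =>
      simp only [grainOut_cons_succ]
      rw [key fun T b b' r r' => f (grainOut (T + occ b - occ b') r r' y)]
      simp only [ih]
      rw [sum_bern_mul_site hpq, Fin.val_succ, pow_succ' _ ((y : ℕ) + 1),
        Module.End.mul_apply]

end Walk

section Correlations

open Matrix

variable {p q : ℝ}

/-- Number of stable particles at the sites up to `x`. -/
def mass (x : Fin L) (r : Fin L → Bool) : ℝ := ((∑ u ∈ Finset.Iic x, occ (r u) : ℤ) : ℝ)

/-- Stationary correlation of the masses up to `x` at two times `n` steps apart. -/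
noncomputable def massCorr (p q : ℝ) (x : Fin L) (n : ℕ) : ℝ :=
  psi p q ⬝ᵥ (mass x * (Wmat p q L ^ n *ᵥ mass x))

lemma grainOut_eq (T : ℤ) (r r' : Fin L → Bool) (x : Fin L) :
    (grainOut T r r' x : ℝ) = T + mass x r - mass x r' := by
  simp only [grainOut, mass, Finset.sum_sub_distrib]
  push_cast
  ring

lemma psi_vecMul_pow (hpq : p + q = 1) (n : ℕ) :
    (psi p q : (Fin L → Bool) → ℝ) ᵥ* Wmat p q L ^ n = psi p q := by
  funext r'
  simp only [vecMul, dotProduct, Wmat_pow hpq]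
  exact sum_psi_mul_grainKernel hpq _ _

lemma psi_dotProduct_mulVec (hpq : p + q = 1) (n : ℕ) (g : (Fin L → Bool) → ℝ) :
    psi p q ⬝ᵥ (Wmat p q L ^ n *ᵥ g) = psi p q ⬝ᵥ g := by
  rw [dotProduct_mulVec, psi_vecMul_pow hpq]

lemma pow_mulVec_one (hpq : p + q = 1) (n : ℕ) :
    (Wmat p q L ^ n *ᵥ 1) = 1 := by
  funext r
  simp only [mulVec, dotProduct, Wmat_pow hpq, Pi.one_apply, mul_one, sum_grainKernel hpq]

lemma psi_dotProduct_one (hpq : p + q = 1) :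
    (psi p q : (Fin L → Bool) → ℝ) ⬝ᵥ 1 = 1 := by
  simp only [dotProduct, Pi.one_apply, mul_one, sum_psi hpq]

/-- Expectation of the toppling number at `x` times a function of the final state. -/
lemma sum_Wmat_mul_grainOut_mul (x : Fin L) (h : (Fin L → Bool) → ℝ) (r : Fin L → Bool) :
    ∑ r', Wmat p q L r r' * ((grainOut 1 r r' x : ℝ) * h r')
      = (Wmat p q L *ᵥ h + mass x * (Wmat p q L *ᵥ h) - Wmat p q L *ᵥ (mass x * h)) r := by
  simp only [Pi.sub_apply, Pi.add_apply, mulVec, dotProduct, Finset.mul_sum,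
    ← Finset.sum_add_distrib, ← Finset.sum_sub_distrib, grainOut_eq, Pi.mul_apply]
  refine Finset.sum_congr rfl fun r' _ => ?_
  push_cast
  ring

lemma sum_Wmat_mul_grainOut (hpq : p + q = 1) (x : Fin L) (r : Fin L → Bool) :
    ∑ r', Wmat p q L r r' * (grainOut 1 r r' x : ℝ)
      = (1 + mass x - Wmat p q L *ᵥ mass x) r := by
  have h := sum_Wmat_mul_grainOut_mul (p := p) (q := q) x 1 r
  have h1 := pow_mulVec_one (L := L) hpq 1
  rw [pow_one] at h1
  rw [h1, mul_one] at h
  simpa only [Pi.one_apply, mul_one] using h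

lemma meanS_eq_one (hpq : p + q = 1) (t : ℕ) (x : Fin L) : meanS p q L t x = 1 := by
  have h : meanS p q L t x
      = psi p q ⬝ᵥ (Wmat p q L ^ (t - 1) *ᵥ (1 + mass x - Wmat p q L ^ 1 *ᵥ mass x)) := by
    rw [pow_one, show 1 + mass x - Wmat p q L *ᵥ mass x
      = fun r => ∑ r', Wmat p q L r r' * (grainOut 1 r r' x : ℝ) from
        funext fun r => (sum_Wmat_mul_grainOut hpq x r).symm]
    simp only [meanS, tsum_Kker_mul hpq, mulVec, dotProduct, Finset.mul_sum]
    refine Finset.sum_congr rfl fun r0 _ => Finset.sum_congr rfl fun r1 _ =>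
      Finset.sum_congr rfl fun r2 _ => ?_
    rw [show Wmat p q L r1 r2 = Wker p q r1 r2 from rfl]
    ring
  rw [h, psi_dotProduct_mulVec hpq, dotProduct_sub, dotProduct_add, psi_dotProduct_mulVec hpq,
    psi_dotProduct_one hpq]
  ring

lemma corrS_eq_dotProduct (hpq : p + q = 1) (t n : ℕ) (x : Fin L) {h : (Fin L → Bool) → ℝ}
    (hh : h = Wmat p q L ^ n *ᵥ (1 + mass x - Wmat p q L *ᵥ mass x)) :
    corrS p q L t (n + 1) x x
      = psi p q ⬝ᵥ (Wmat p q L ^ (t - 1) *ᵥ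
          (Wmat p q L *ᵥ h + mass x * (Wmat p q L *ᵥ h) - Wmat p q L *ᵥ (mass x * h))) := by
  rw [show Wmat p q L *ᵥ h + mass x * (Wmat p q L *ᵥ h) - Wmat p q L *ᵥ (mass x * h)
      = fun r => ∑ r', Wmat p q L r r' * ((grainOut 1 r r' x : ℝ) * h r') from
        funext fun r => (sum_Wmat_mul_grainOut_mul x h r).symm,
    hh, show 1 + mass x - Wmat p q L *ᵥ mass x
      = fun r => ∑ r', Wmat p q L r r' * (grainOut 1 r r' x : ℝ) from
        funext fun r => (sum_Wmat_mul_grainOut hpq x r).symm]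
  simp only [corrS, tsum_Kker_mul hpq, tsum_mul_right, mulVec, dotProduct, Finset.mul_sum,
    Nat.add_sub_cancel]
  refine Finset.sum_congr rfl fun r0 _ => Finset.sum_congr rfl fun r1 _ =>
    Finset.sum_congr rfl fun r2 _ => Finset.sum_congr rfl fun r3 _ =>
    Finset.sum_congr rfl fun r4 _ => ?_
  rw [show Wmat p q L r1 r2 = Wker p q r1 r2 from rfl,
    show Wmat p q L r3 r4 = Wker p q r3 r4 from rfl]
  ring

lemma corrS_eq (hpq : p + q = 1) (t n : ℕ) (x : Fin L) :
    corrS p q L t (n + 1) x x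
      = 1 + 2 * massCorr p q x (n + 1) - massCorr p q x (n + 2) - massCorr p q x n := by
  have hh : Wmat p q L ^ n *ᵥ (1 + mass x - Wmat p q L *ᵥ mass x)
      = 1 + Wmat p q L ^ n *ᵥ mass x - Wmat p q L ^ (n + 1) *ᵥ mass x := by
    rw [mulVec_sub, mulVec_add, mulVec_mulVec, ← pow_succ, pow_mulVec_one hpq]
  have h1 := pow_mulVec_one (L := L) hpq 1
  have hψ : ∀ g : (Fin L → Bool) → ℝ, psi p q ⬝ᵥ (Wmat p q L *ᵥ g) = psi p q ⬝ᵥ g := by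
    intro g
    simpa only [pow_one] using psi_dotProduct_mulVec hpq 1 g
  rw [pow_one] at h1
  rw [corrS_eq_dotProduct hpq t n x rfl, hh, psi_dotProduct_mulVec hpq]
  have hW : Wmat p q L *ᵥ (1 + Wmat p q L ^ n *ᵥ mass x - Wmat p q L ^ (n + 1) *ᵥ mass x)
      = 1 + Wmat p q L ^ (n + 1) *ᵥ mass x - Wmat p q L ^ (n + 2) *ᵥ mass x := by
    rw [mulVec_sub, mulVec_add, mulVec_mulVec, mulVec_mulVec, ← pow_succ', ← pow_succ', h1]
  simp only [dotProduct_sub, dotProduct_add, hψ, hW, mul_sub, mul_add, mul_one,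
    psi_dotProduct_mulVec hpq, psi_dotProduct_one hpq, massCorr]
  ring

lemma walkStep_pow_sq_eq (hpq : p + q = 1) (n : ℕ) (x : Fin L) :
    (walkStep (p * q) ^ ((x : ℕ) + 1)) (fun n => (n : ℝ) ^ 2) n
      = n ^ 2 + 2 * (psi p q ⬝ᵥ mass x ^ 2) - 2 * massCorr p q x n := by
  have h : (walkStep (p * q) ^ ((x : ℕ) + 1)) (fun n => (n : ℝ) ^ 2) n
      = psi p q ⬝ᵥ ((n : ℝ) ^ 2 • (Wmat p q L ^ n *ᵥ 1)
        + (2 * n : ℝ) • (mass x * (Wmat p q L ^ n *ᵥ 1) - Wmat p q L ^ n *ᵥ mass x)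
        + mass x ^ 2 * (Wmat p q L ^ n *ᵥ 1) + Wmat p q L ^ n *ᵥ (mass x ^ 2)
        - (2 : ℝ) • (mass x * (Wmat p q L ^ n *ᵥ mass x))) := by
    rw [← sum_psi_mul_grainOut hpq]
    refine Finset.sum_congr rfl fun r _ => ?_
    simp only [Pi.sub_apply, Pi.add_apply, Pi.smul_apply, Pi.mul_apply, Pi.pow_apply,
      Pi.one_apply, smul_eq_mul, mulVec, dotProduct, Wmat_pow hpq, Finset.mul_sum,
      ← Finset.sum_add_distrib, ← Finset.sum_sub_distrib]
    refine Finset.sum_congr rfl fun r' _ => ?_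
    rw [grainOut_eq]
    push_cast
    ring
  simp only [h, dotProduct_sub, dotProduct_add, dotProduct_smul, pow_mulVec_one hpq, mul_one,
    psi_dotProduct_mulVec hpq, psi_dotProduct_one hpq, massCorr, smul_eq_mul]
  ring

/-- The covariance is minus the probability that `τ` particles added to the stationary state
cause no toppling at `x`. -/
lemma covS_eq (hp : 0 < p) (hq : 0 < q) (hpq : p + q = 1) (x : Fin L) (t : ℕ) {τ : ℕ}
    (hτ : 1 ≤ τ) :
    covS p q L t τ x = -(walkStep (p * q) ^ ((x : ℕ) + 1)) absorbed τ := by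
  obtain ⟨n, rfl⟩ : ∃ n, τ = n + 1 := ⟨τ - 1, by omega⟩
  have h := walkStep_pow_sq_second_difference (mul_pos hp hq).ne' ((x : ℕ) + 1)
    (n := ((n + 1 : ℕ) : ℤ)) (by push_cast; omega)
  rw [show ((n + 1 : ℕ) : ℤ) + 1 = ((n + 2 : ℕ) : ℤ) by push_cast; ring,
    show ((n + 1 : ℕ) : ℤ) - 1 = (n : ℤ) by push_cast; ring,
    walkStep_pow_sq_eq hpq, walkStep_pow_sq_eq hpq, walkStep_pow_sq_eq hpq] at h
  rw [covS, corrS_eq hpq, meanS_eq_one hpq, meanS_eq_one hpq]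
  push_cast at h ⊢
  linarith

end Correlations

/-- local avalanches are anticorrelated. For a site of Lean index `x`
(paper site `x+1`), `t ≥ 1`, `τ ≥ 1`: if `τ ≤ x+1` then `Cov(s(x,t), s(x,t+τ)) < 0`,
and if `τ ≥ x+2` then `Cov(s(x,t), s(x,t+τ)) = 0`. -/
theorem local_avalanches_anticorrelated
    (L : ℕ) (hL : 0 < L) (p q : ℝ) (hp : 0 < p) (hq : 0 < q) (hpq : p + q = 1)
    (x : Fin L) (t τ : ℕ) (ht : 1 ≤ t) (hτ : 1 ≤ τ) :
    (τ ≤ (x : ℕ) + 1 → covS p q L t τ x < 0) ∧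
    ((x : ℕ) + 2 ≤ τ → covS p q L t τ x = 0) := by
  have ha : 2 * (p * q) ≤ 1 := by nlinarith [sq_nonneg (p - q)]
  rw [covS_eq hp hq hpq x t hτ]
  constructor
  · intro h
    exact neg_neg_of_pos (walkStep_pow_absorbed_pos (mul_pos hp hq) ha _ (by exact_mod_cast h))
  · intro h
    rw [walkStep_pow_absorbed_eq_zero _ _ (by exact_mod_cast h), neg_zero]

end DSS
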